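/- arXiv:2402.06328 — 3 statements merged into one kernel-verified Lean document; each statement's English description precedes it below -/
import Mathlib

section
/- For every Hurst parameter H ∈ (1/2, 1) and every continuous compactly supported function f : ℝ → ℝ, the double integral ∫_ℝ ∫_ℝ f(s) f(t) H(2H−1)|s−t|^{2H−2} ds dt is nonnegative. That is, the bilinear form ⟨f,g⟩_φ = ∫_ℝ ∫_ℝ f(t) g(s) φ(s,t) ds dt, with φ(s,t) = H(2H−1)|s−t|^{2H−2}, is positive semidefinite. -/
open MeasureTheory

/-- The one-sided power kernel `y ↦ y₊ ^ (-b)`, vanishing on `(-∞, 0]`. -/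
noncomputable def oneSidedPow (b : ℝ) : ℝ → ℝ :=
  (Set.Ioi 0).indicator fun y => y ^ (-b)

lemma oneSidedPow_nonneg (b y : ℝ) : 0 ≤ oneSidedPow b y :=
  Set.indicator_nonneg (fun _ hx => Real.rpow_nonneg (le_of_lt hx) _) y

lemma measurable_oneSidedPow (b : ℝ) : Measurable (oneSidedPow b) :=
  (measurable_id.pow_const _).indicator measurableSet_Ioi

lemma oneSidedPow_of_pos {b y : ℝ} (hy : 0 < y) : oneSidedPow b y = y ^ (-b) :=
  Set.indicator_of_mem (Set.mem_Ioi.2 hy) _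

lemma oneSidedPow_of_nonpos {b y : ℝ} (hy : y ≤ 0) : oneSidedPow b y = 0 :=
  Set.indicator_of_notMem (Set.notMem_Ioi.2 hy) _

lemma oneSidedPow_mul {b d : ℝ} (hd : 0 < d) (y : ℝ) :
    oneSidedPow b (d * y) = d ^ (-b) * oneSidedPow b y := by
  rcases lt_or_ge 0 y with hy | hy
  · rw [oneSidedPow_of_pos hy, oneSidedPow_of_pos (mul_pos hd hy), Real.mul_rpow hd.le hy.le]
  · rw [oneSidedPow_of_nonpos hy,
      oneSidedPow_of_nonpos (mul_nonpos_of_nonneg_of_nonpos hd.le hy), mul_zero]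

lemma integrable_oneSidedPow_mul_shift {b : ℝ} (hb₁ : 1 / 2 < b) (hb₂ : b < 1) :
    Integrable fun y => oneSidedPow b (y + 1) * oneSidedPow b y := by
  have hmeas : Measurable fun y => oneSidedPow b (y + 1) * oneSidedPow b y :=
    ((measurable_oneSidedPow b).comp (measurable_id.add_const 1)).mul (measurable_oneSidedPow b)
  have hnear : IntegrableOn (fun y : ℝ => y ^ (-b)) (Set.Ioc 0 1) :=
    (intervalIntegrable_iff_integrableOn_Ioc_of_le zero_le_one).1
      (intervalIntegral.intervalIntegrable_rpow' (by linarith))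
  have hfar : IntegrableOn (fun y : ℝ => y ^ (-(2 * b))) (Set.Ioi 1) :=
    integrableOn_Ioi_rpow_of_lt (by linarith) one_pos
  refine Integrable.mono' ((hnear.integrable_indicator measurableSet_Ioc).add
    (hfar.integrable_indicator measurableSet_Ioi)) hmeas.aestronglyMeasurable
    (Filter.Eventually.of_forall fun y => ?_)
  rw [Real.norm_of_nonneg (mul_nonneg (oneSidedPow_nonneg _ _) (oneSidedPow_nonneg _ _)),
    Pi.add_apply]
  rcases le_or_gt y 0 with hy | hy
  · rw [oneSidedPow_of_nonpos hy, mul_zero, Set.indicator_of_notMem (by simp [hy]),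
      Set.indicator_of_notMem (by simp; linarith), add_zero]
  have hy0 : 0 ≤ y ^ (-b) := Real.rpow_nonneg hy.le _
  rw [oneSidedPow_of_pos hy, oneSidedPow_of_pos (by linarith : 0 < y + 1)]
  rcases le_or_gt y 1 with h1 | h1
  · rw [Set.indicator_of_mem (Set.mem_Ioc.2 ⟨hy, h1⟩),
      Set.indicator_of_notMem (by simpa using h1), add_zero]
    exact mul_le_of_le_one_left hy0
      (Real.rpow_le_one_of_one_le_of_nonpos (by linarith) (by linarith))
  · rw [Set.indicator_of_notMem (by simp [h1]), Set.indicator_of_mem (Set.mem_Ioi.2 h1), zero_add,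
      show -(2 * b) = -b + -b by ring, Real.rpow_add hy]
    exact mul_le_mul_of_nonneg_right
      (Real.rpow_le_rpow_of_nonpos hy (by linarith) (by linarith)) hy0

lemma integral_oneSidedPow_mul_shift_pos {b : ℝ} (hb₁ : 1 / 2 < b) (hb₂ : b < 1) :
    0 < ∫ y, oneSidedPow b (y + 1) * oneSidedPow b y := by
  rw [integral_pos_iff_support_of_nonneg
    (fun y => mul_nonneg (oneSidedPow_nonneg _ _) (oneSidedPow_nonneg _ _))
    (integrable_oneSidedPow_mul_shift hb₁ hb₂)]
  refine lt_of_lt_of_le (by simp) (measure_mono (s := Set.Ioi (0 : ℝ)) fun y hy => ?_)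
  have hy : 0 < y := hy
  rw [Function.mem_support, oneSidedPow_of_pos hy, oneSidedPow_of_pos (by linarith : 0 < y + 1)]
  positivity

lemma oneSidedPow_sub_mul_sub {b s t : ℝ} (h : s < t) (x : ℝ) :
    oneSidedPow b (x - s) * oneSidedPow b (x - t) =
      (t - s) ^ (-(2 * b)) *
        (oneSidedPow b ((x - t) / (t - s) + 1) * oneSidedPow b ((x - t) / (t - s))) := by
  have hd : 0 < t - s := sub_pos.2 h
  have h1 : x - s = (t - s) * ((x - t) / (t - s) + 1) := by field_simp; ring
  have h2 : x - t = (t - s) * ((x - t) / (t - s)) := by field_simp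
  rw [h1]
  nth_rewrite 2 [h2]
  rw [oneSidedPow_mul hd, oneSidedPow_mul hd, show -(2 * b) = -b + -b by ring, Real.rpow_add hd]
  ring

lemma integrable_oneSidedPow_sub_mul_sub {b : ℝ} (hb₁ : 1 / 2 < b) (hb₂ : b < 1) {s t : ℝ}
    (hst : s ≠ t) : Integrable fun x => oneSidedPow b (x - s) * oneSidedPow b (x - t) := by
  wlog h : s < t generalizing s t
  · simpa only [mul_comm] using this hst.symm (lt_of_le_of_ne (not_lt.1 h) hst.symm)
  simp_rw [oneSidedPow_sub_mul_sub h]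
  exact (((integrable_oneSidedPow_mul_shift hb₁ hb₂).comp_div
    (sub_pos.2 h).ne').comp_sub_right t).const_mul _

/-- The Riesz kernel is a superposition of products of one-sided power kernels. -/
lemma integral_oneSidedPow_sub_mul_sub (b : ℝ) {s t : ℝ} (hst : s ≠ t) :
    ∫ x, oneSidedPow b (x - s) * oneSidedPow b (x - t) =
      (∫ y, oneSidedPow b (y + 1) * oneSidedPow b y) * |s - t| ^ (1 - 2 * b) := by
  wlog h : s < t generalizing s t
  · simpa only [mul_comm, abs_sub_comm] using
      this hst.symm (lt_of_le_of_ne (not_lt.1 h) hst.symm)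
  have hd : 0 < t - s := sub_pos.2 h
  simp_rw [oneSidedPow_sub_mul_sub h]
  rw [integral_const_mul,
    integral_sub_right_eq_self (fun x => oneSidedPow b (x / (t - s) + 1) *
      oneSidedPow b (x / (t - s))) t,
    Measure.integral_comp_div (fun y => oneSidedPow b (y + 1) * oneSidedPow b y) (t - s),
    abs_sub_comm s t, abs_of_pos hd, smul_eq_mul, show 1 - 2 * b = -(2 * b) + 1 by ring,
    Real.rpow_add hd, Real.rpow_one]
  ring

lemma locallyIntegrable_abs_rpow {p : ℝ} (hp : -1 < p) :
    LocallyIntegrable fun r : ℝ => |r| ^ p := by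
  have hpos (c : ℝ) : IntervalIntegrable (fun r : ℝ => |r| ^ p) volume 0 c := by
    wlog hc : 0 ≤ c generalizing c
    · simpa using (IntervalIntegrable.iff_comp_neg (by simp)).1 (this (-c) (by linarith))
    refine (intervalIntegral.intervalIntegrable_rpow' (a := 0) (b := c) hp).congr fun r hr => ?_
    rw [Set.uIoc_of_le hc] at hr
    simp only [abs_of_pos hr.1]
  rw [locallyIntegrable_iff]
  intro K hK
  obtain ⟨R, hR⟩ := hK.isBounded.subset_closedBall 0
  rw [Real.closedBall_eq_Icc] at hR
  rcases le_or_gt (0 - R) (0 + R) with h | h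
  · exact IntegrableOn.mono_set ((intervalIntegrable_iff_integrableOn_Icc_of_le h).1
      ((hpos _).symm.trans (hpos _))) hR
  · rw [Set.Icc_eq_empty h.not_ge] at hR
    rw [Set.subset_empty_iff.1 hR]
    exact integrableOn_empty

lemma integrable_mul_mul_abs_sub_rpow {p : ℝ} (hp : -1 < p) {f : ℝ → ℝ} (hf : Continuous f)
    (hsupp : HasCompactSupport f) :
    Integrable (fun z : ℝ × ℝ => f z.1 * f z.2 * |z.1 - z.2| ^ p) (volume.prod volume) := by
  have hmeas : Measurable fun z : ℝ × ℝ => f z.1 * f z.2 * |z.1 - z.2| ^ p :=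
    ((hf.measurable.comp measurable_fst).mul (hf.measurable.comp measurable_snd)).mul
      ((measurable_fst.sub measurable_snd).abs.pow_const p)
  have hloc := locallyIntegrable_abs_rpow hp
  have hg : Continuous fun t => |f t| := hf.abs
  have hgs : HasCompactSupport fun t => |f t| := hsupp.abs
  have hex := hgs.convolutionExists_left (ContinuousLinearMap.mul ℝ ℝ) hg hloc
  have hcont := hgs.continuous_convolution_left (ContinuousLinearMap.mul ℝ ℝ) hg hloc
  have hnorm (s t : ℝ) : ‖f s * f t * |s - t| ^ p‖ = |f s| * (|f t| * |s - t| ^ p) := by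
    rw [norm_mul, norm_mul, Real.norm_eq_abs, Real.norm_eq_abs,
      Real.norm_of_nonneg (Real.rpow_nonneg (abs_nonneg _) _), mul_assoc]
  rw [integrable_prod_iff hmeas.aestronglyMeasurable]
  refine ⟨Filter.Eventually.of_forall fun s => ?_, ?_⟩
  · refine Integrable.mono' ((hex s).integrable.const_mul |f s|)
      (hmeas.comp measurable_prodMk_left).aestronglyMeasurable
      (Filter.Eventually.of_forall fun t => (hnorm s t).le)
  · simp_rw [hnorm, integral_const_mul]
    exact (hg.mul hcont).integrable_of_hasCompactSupport hgs.mul_right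

lemma ae_prod_ne : ∀ᵐ z : ℝ × ℝ ∂(volume.prod volume), z.1 ≠ z.2 := by
  have h : (volume.prod volume : Measure (ℝ × ℝ)) (Set.diagonal ℝ) = 0 := by
    rw [Measure.measure_prod_null measurableSet_diagonal]
    refine Filter.Eventually.of_forall fun s => ?_
    have : Prod.mk s ⁻¹' Set.diagonal ℝ = {s} := by
      ext t
      simp [eq_comm]
    simp [this]
  exact measure_mono_null (fun z hz => not_not.1 hz) h

lemma integral_mul_mul_abs_sub_rpow_nonneg {p : ℝ} (hp₁ : -1 < p) (hp₂ : p < 0) {f : ℝ → ℝ}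
    (hf : Continuous f) (hsupp : HasCompactSupport f) :
    0 ≤ ∫ s, ∫ t, f s * f t * |s - t| ^ p := by
  obtain ⟨b, rfl⟩ : ∃ b, p = 1 - 2 * b := ⟨(1 - p) / 2, by ring⟩
  have hb₁ : 1 / 2 < b := by linarith
  have hb₂ : b < 1 := by linarith
  set C := ∫ y, oneSidedPow b (y + 1) * oneSidedPow b y
  have hCpos : 0 < C := integral_oneSidedPow_mul_shift_pos hb₁ hb₂
  have hint := integrable_mul_mul_abs_sub_rpow hp₁ hf hsupp
  let F : ℝ × ℝ → ℝ → ℝ := fun z x =>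
    f z.1 * f z.2 * (oneSidedPow b (x - z.1) * oneSidedPow b (x - z.2))
  have hFmeas : Measurable (Function.uncurry F) := by
    have hk := measurable_oneSidedPow b
    have hfm := hf.measurable
    simp only [F, Function.uncurry_def]
    fun_prop
  have hFint : Integrable (Function.uncurry F) ((volume.prod volume).prod volume) := by
    rw [integrable_prod_iff hFmeas.aestronglyMeasurable]
    constructor
    · filter_upwards [ae_prod_ne] with z hz
      exact (integrable_oneSidedPow_sub_mul_sub hb₁ hb₂ hz).const_mul (f z.1 * f z.2)
    · refine (hint.norm.const_mul C).congr ?_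
      filter_upwards [ae_prod_ne] with z hz
      have hn (x : ℝ) : ‖Function.uncurry F (z, x)‖ =
          ‖f z.1 * f z.2‖ * (oneSidedPow b (x - z.1) * oneSidedPow b (x - z.2)) := by
        simp only [F, Function.uncurry_apply_pair]
        rw [norm_mul, Real.norm_of_nonneg
          (mul_nonneg (oneSidedPow_nonneg b (x - z.1)) (oneSidedPow_nonneg b (x - z.2)))]
      simp_rw [hn]
      rw [integral_const_mul, integral_oneSidedPow_sub_mul_sub b hz, norm_mul (f z.1 * f z.2),
        Real.norm_of_nonneg (Real.rpow_nonneg (abs_nonneg (z.1 - z.2)) _)]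
      ring
  have hinner : (fun z => C * (f z.1 * f z.2 * |z.1 - z.2| ^ (1 - 2 * b)))
      =ᵐ[volume.prod volume] fun z => ∫ x, F z x := by
    filter_upwards [ae_prod_ne] with z hz
    simp only [F]
    rw [integral_const_mul, integral_oneSidedPow_sub_mul_sub b hz]
    ring
  have hsq (x : ℝ) : ∫ z, F z x ∂(volume.prod volume) =
      (∫ s, f s * oneSidedPow b (x - s)) * ∫ t, f t * oneSidedPow b (x - t) := by
    rw [← integral_prod_mul]
    congr 1
    ext z
    simp only [F]
    ring
  rw [← integral_prod _ hint]
  refine nonneg_of_mul_nonneg_right ?_ hCpos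
  rw [← integral_const_mul, integral_congr_ae hinner, integral_integral_swap hFint]
  refine integral_nonneg fun x => ?_
  rw [Pi.zero_apply, hsq]
  exact mul_self_nonneg _



/-- For `H ∈ (1/2, 1)` and every continuous compactly supported `f : ℝ → ℝ`, the bilinear form
`⟨f,f⟩_φ = ∫_ℝ ∫_ℝ f(s) f(t) H(2H−1)|s−t|^{2H−2} ds dt` is nonnegative, i.e. the kernel
`φ(s,t) = H(2H−1)|s−t|^{2H−2}` is positive semidefinite. -/
theorem fbm_kernel_posSemidef (H : ℝ) (hH₁ : 1 / 2 < H) (hH₂ : H < 1)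
    (f : ℝ → ℝ) (hf : Continuous f) (hsupp : HasCompactSupport f) :
    0 ≤ ∫ s : ℝ, ∫ t : ℝ, f s * f t * (H * (2 * H - 1) * |s - t| ^ (2 * H - 2)) := by
  have h := integral_mul_mul_abs_sub_rpow_nonneg (p := 2 * H - 2) (by linarith) (by linarith)
    hf hsupp
  have hκ : 0 ≤ H * (2 * H - 1) := mul_nonneg (by linarith) (by linarith)
  simp_rw [mul_left_comm _ (H * (2 * H - 1)), integral_const_mul]
  exact mul_nonneg hκ h
end

section
/- For every Hurst parameter H ∈ (1/2, 1), the fractional Brownian motion covariance function R_H(s,t) = (1/2)(s^{2H} + t^{2H} − |t−s|^{2H}) is a positive semidefinite kernel on [0,∞): for every n ∈ ℕ, all times t₁, …, tₙ ≥ 0 and all real coefficients a₁, …, aₙ, one has Σ_{i=1}^n Σ_{j=1}^n a_i a_j R_H(t_i, t_j) ≥ 0. -/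
open MeasureTheory Set

lemma integrableOn_one_sub_cos_mul_rpow {p : ℝ} (hp₀ : 0 < p) (hp₂ : p < 2) (x : ℝ) :
    IntegrableOn (fun u : ℝ => (1 - Real.cos (x * u)) * u ^ (-1 - p)) (Ioi 0) := by
  have hmeas : Measurable (fun u : ℝ => (1 - Real.cos (x * u)) * u ^ (-1 - p)) := by
    fun_prop
  rw [← Ioc_union_Ioi_eq_Ioi (zero_le_one (α := ℝ))]
  refine IntegrableOn.union ?_ ?_
  · have hint : IntegrableOn (fun u : ℝ => x ^ 2 / 2 * u ^ (1 - p)) (Ioc 0 1) :=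
      ((intervalIntegrable_iff_integrableOn_Ioc_of_le zero_le_one).1
        (intervalIntegral.intervalIntegrable_rpow' (by linarith))).const_mul _
    refine Integrable.mono' hint hmeas.aestronglyMeasurable ?_
    filter_upwards [ae_restrict_mem measurableSet_Ioc] with u hu
    have hpow : u ^ (1 - p) = u ^ 2 * u ^ (-1 - p) := by
      rw [← Real.rpow_natCast, ← Real.rpow_add hu.1]
      congr 1
      push_cast
      ring
    have hcos : 1 - Real.cos (x * u) ≤ x ^ 2 / 2 * u ^ 2 := by
      linarith [Real.one_sub_sq_div_two_le_cos (x := x * u), mul_pow x u 2]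
    have hnn : 0 ≤ u ^ (-1 - p) := Real.rpow_nonneg hu.1.le _
    rw [Real.norm_of_nonneg
      (mul_nonneg (sub_nonneg.2 (Real.cos_le_one _)) hnn), hpow, ← mul_assoc]
    exact mul_le_mul_of_nonneg_right hcos hnn
  · have hint : IntegrableOn (fun u : ℝ => 2 * u ^ (-1 - p)) (Ioi 1) :=
      (integrableOn_Ioi_rpow_of_lt (by linarith) one_pos).const_mul _
    refine Integrable.mono' hint hmeas.aestronglyMeasurable ?_
    filter_upwards [ae_restrict_mem measurableSet_Ioi] with u hu
    have hnn : 0 ≤ u ^ (-1 - p) := Real.rpow_nonneg (zero_le_one.trans (le_of_lt hu)) _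
    rw [Real.norm_of_nonneg (mul_nonneg (sub_nonneg.2 (Real.cos_le_one _)) hnn)]
    exact mul_le_mul_of_nonneg_right (by linarith [Real.neg_one_le_cos (x * u)]) hnn

lemma integral_one_sub_cos_mul_rpow_pos {p : ℝ} (hp₀ : 0 < p) (hp₂ : p < 2) :
    0 < ∫ u in Ioi (0 : ℝ), (1 - Real.cos u) * u ^ (-1 - p) := by
  have hint := integrableOn_one_sub_cos_mul_rpow hp₀ hp₂ 1
  simp only [one_mul] at hint
  rw [setIntegral_pos_iff_support_of_nonneg_ae _ hint]
  · refine lt_of_lt_of_le ?_ (measure_mono (s := Ioo (0 : ℝ) 1) ?_)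
    · simp
    · intro u hu
      have hcos : Real.cos u < 1 := by
        simpa using Real.cos_lt_cos_of_nonneg_of_le_pi le_rfl
          (by linarith [hu.2, Real.pi_gt_three]) hu.1
      exact ⟨(mul_pos (sub_pos.2 hcos) (Real.rpow_pos_of_pos hu.1 _)).ne', hu.1⟩
  · filter_upwards [ae_restrict_mem measurableSet_Ioi] with u hu
    exact mul_nonneg (sub_nonneg.2 (Real.cos_le_one _)) (Real.rpow_nonneg (le_of_lt hu) _)

lemma integral_one_sub_cos_mul_rpow {p : ℝ} (hp₀ : 0 < p) (x : ℝ) :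
    ∫ u in Ioi (0 : ℝ), (1 - Real.cos (x * u)) * u ^ (-1 - p) =
      |x| ^ p * ∫ u in Ioi (0 : ℝ), (1 - Real.cos u) * u ^ (-1 - p) := by
  rcases eq_or_ne x 0 with rfl | hx
  · simp [Real.zero_rpow hp₀.ne']
  have hx' : 0 < |x| := abs_pos.2 hx
  have hscale := integral_comp_mul_left_Ioi
    (fun u : ℝ => (1 - Real.cos u) * u ^ (-1 - p)) 0 hx'
  rw [mul_zero, smul_eq_mul] at hscale
  have hpow : |x| ^ p * |x| = |x| ^ (1 + p) := by
    rw [Real.rpow_add hx', Real.rpow_one, mul_comm]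
  have hmul : |x| ^ (1 + p) * ∫ u in Ioi (0 : ℝ), (1 - Real.cos (|x| * u)) * (|x| * u) ^ (-1 - p) =
      ∫ u in Ioi (0 : ℝ), (1 - Real.cos (x * u)) * u ^ (-1 - p) := by
    rw [← integral_const_mul]
    refine setIntegral_congr_fun measurableSet_Ioi fun u hu => ?_
    have hu' : (0 : ℝ) < u := hu
    have hcos : Real.cos (|x| * u) = Real.cos (x * u) := by
      rw [← Real.cos_abs (x * u), abs_mul, abs_of_pos hu']
    have hcancel : |x| ^ (1 + p) * |x| ^ (-1 - p) = 1 := by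
      rw [← Real.rpow_add hx']
      simp
    simp only [hcos, Real.mul_rpow hx'.le hu'.le]
    linear_combination (1 - Real.cos (x * u)) * u ^ (-1 - p) * hcancel
  rw [← hmul, hscale, ← hpow]
  field_simp

lemma sum_sum_one_sub_cos_nonneg {ι : Type*} [Fintype ι] (t a : ι → ℝ) (u : ℝ) :
    0 ≤ ∑ i, ∑ j, a i * a j * ((1 - Real.cos (t i * u)) + (1 - Real.cos (t j * u))
      - (1 - Real.cos ((t j - t i) * u))) := by
  have hsq : ∑ i, ∑ j, a i * a j * ((1 - Real.cos (t i * u)) + (1 - Real.cos (t j * u))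
      - (1 - Real.cos ((t j - t i) * u))) =
      (∑ i, a i * (1 - Real.cos (t i * u))) ^ 2 + (∑ i, a i * Real.sin (t i * u)) ^ 2 := by
    rw [sq, sq, Finset.sum_mul_sum, Finset.sum_mul_sum, ← Finset.sum_add_distrib]
    refine Finset.sum_congr rfl fun i _ => ?_
    rw [← Finset.sum_add_distrib]
    refine Finset.sum_congr rfl fun j _ => ?_
    rw [sub_mul, Real.cos_sub]
    ring
  rw [hsq]
  positivity

/-- For every Hurst parameter `H ∈ (1/2, 1)`, the fBm covariance
`R_H(s,t) = (1/2)(s^{2H} + t^{2H} − |t−s|^{2H})` is a positive semidefinite kernel on `[0,∞)`. -/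
theorem fbm_covariance_posSemidef (H : ℝ) (hH₁ : 1 / 2 < H) (hH₂ : H < 1)
    (n : ℕ) (t : Fin n → ℝ) (ht : ∀ i, 0 ≤ t i) (a : Fin n → ℝ) :
    0 ≤ ∑ i : Fin n, ∑ j : Fin n,
      a i * a j *
        ((1 / 2) * ((t i) ^ (2 * H) + (t j) ^ (2 * H) - |t j - t i| ^ (2 * H))) := by
  have hp₀ : 0 < 2 * H := by linarith
  have hp₂ : 2 * H < 2 := by linarith
  have hpos := integral_one_sub_cos_mul_rpow_pos hp₀ hp₂
  set c : ℝ := ∫ u in Ioi (0 : ℝ), (1 - Real.cos u) * u ^ (-1 - 2 * H)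
  let g : ℝ → ℝ → ℝ := fun x u => (1 - Real.cos (x * u)) * u ^ (-1 - 2 * H)
  have hint (x : ℝ) : IntegrableOn (fun u => g x u) (Ioi 0) :=
    integrableOn_one_sub_cos_mul_rpow hp₀ hp₂ x
  have hadd (x y : ℝ) : IntegrableOn (fun u => g x u + g y u) (Ioi 0) := (hint x).add (hint y)
  have heval (x : ℝ) : ∫ u in Ioi (0 : ℝ), g x u = |x| ^ (2 * H) * c :=
    integral_one_sub_cos_mul_rpow hp₀ x
  have hterm (i j : Fin n) : IntegrableOn
      (fun u => a i * a j * (g (t i) u + g (t j) u - g (t j - t i) u)) (Ioi 0) :=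
    ((hadd _ _).sub (hint _)).const_mul _
  have hrepr : ∫ u in Ioi (0 : ℝ),
      ∑ i, ∑ j, a i * a j * (g (t i) u + g (t j) u - g (t j - t i) u) =
      2 * c * ∑ i : Fin n, ∑ j : Fin n, a i * a j *
        ((1 / 2) * ((t i) ^ (2 * H) + (t j) ^ (2 * H) - |t j - t i| ^ (2 * H))) := by
    rw [integral_finsetSum _ fun i _ => integrable_finsetSum _ fun j _ => hterm i j,
      Finset.mul_sum]
    refine Finset.sum_congr rfl fun i _ => ?_
    rw [integral_finsetSum _ fun j _ => hterm i j, Finset.mul_sum]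
    refine Finset.sum_congr rfl fun j _ => ?_
    rw [integral_const_mul, integral_sub (hadd _ _) (hint _),
      integral_add (hint _) (hint _), heval, heval, heval, abs_of_nonneg (ht i),
      abs_of_nonneg (ht j)]
    ring
  refine nonneg_of_mul_nonneg_right ?_ (mul_pos two_pos hpos)
  rw [← hrepr]
  refine setIntegral_nonneg measurableSet_Ioi fun u hu => ?_
  refine (mul_nonneg (sum_sum_one_sub_cos_nonneg t a u)
    (Real.rpow_nonneg (le_of_lt hu) (-1 - 2 * H))).trans_eq ?_
  simp only [g, Finset.sum_mul]
  refine Finset.sum_congr rfl fun i _ => Finset.sum_congr rfl fun j _ => ?_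
  ring
end

section
/- Let d, n ∈ ℕ and let γ be the standard Gaussian measure on ℝ^d (the d-fold product of the one-dimensional standard Gaussian measure gaussianReal 0 1). Let v₁, …, vₙ ∈ ℝ^d be pairwise distinct vectors and a₁, …, aₙ ∈ ℝ. If Σ_{i=1}^n a_i · exp(⟨v_i, x⟩ − ‖v_i‖²/2) = 0 for γ-almost every x ∈ ℝ^d, then a_i = 0 for all i. That is, the exponential functionals x ↦ exp(⟨v_i, x⟩ − ‖v_i‖²/2) associated to pairwise distinct vectors are linearly independent in L²(γ). -/
open MeasureTheory ProbabilityTheory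

theorem isOpenPosMeasure_gaussianReal (μ : ℝ) {v : NNReal} (hv : v ≠ 0) :
    (gaussianReal μ v).IsOpenPosMeasure :=
  (gaussianReal_absolutelyContinuous' μ hv).isOpenPosMeasure

/-- The character `x ↦ exp (v ⬝ᵥ x)` of the additive group `ι → ℝ`. -/
noncomputable def expDotProduct {ι : Type*} [Fintype ι] (v : ι → ℝ) :
    Multiplicative (ι → ℝ) →* ℝ where
  toFun x := Real.exp (v ⬝ᵥ x.toAdd)
  map_one' := by simp
  map_mul' x y := by rw [toAdd_mul, dotProduct_add, Real.exp_add]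

theorem expDotProduct_injective {ι : Type*} [Fintype ι] :
    Function.Injective (expDotProduct (ι := ι)) := by
  classical
  intro v w h
  funext j
  simpa [expDotProduct] using DFunLike.congr_fun h (Multiplicative.ofAdd (Pi.single j 1))

/-- Linear independence of Gaussian exponential functionals: if `v₁, …, vₙ ∈ ℝ^d` are pairwise
distinct and `Σᵢ aᵢ exp(⟨vᵢ,x⟩ − ‖vᵢ‖²/2) = 0` for `γ`-a.e. `x`, where `γ` is the standard
Gaussian measure on `ℝ^d`, then all `aᵢ = 0`. -/
theorem gaussian_exponentials_linearIndependent (d n : ℕ)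
    (v : Fin n → (Fin d → ℝ)) (hv : Function.Injective v) (a : Fin n → ℝ)
    (h : ∀ᵐ x ∂(Measure.pi fun _ : Fin d => gaussianReal 0 1),
      ∑ i : Fin n,
        a i * Real.exp ((∑ j : Fin d, v i j * x j) - (∑ j : Fin d, (v i j) ^ 2) / 2) = 0) :
    ∀ i, a i = 0 := by
  have := isOpenPosMeasure_gaussianReal 0 one_ne_zero
  have hzero := Measure.eq_of_ae_eq h (by fun_prop) continuous_const
  have hli := (linearIndependent_monoidHom (Multiplicative (Fin d → ℝ)) ℝ).comp _
    (expDotProduct_injective.comp hv)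
  have hcoef := Fintype.linearIndependent_iff.mp hli
    (fun i => a i * Real.exp (-((∑ j, (v i j) ^ 2) / 2))) <| by
      funext x
      rw [Finset.sum_apply]
      refine Eq.trans (Finset.sum_congr rfl fun i _ => ?_) (congr_fun hzero x.toAdd)
      change a i * Real.exp (-((∑ j, (v i j) ^ 2) / 2)) * Real.exp (v i ⬝ᵥ x.toAdd) = _
      rw [mul_assoc, ← Real.exp_add, neg_add_eq_sub]
      rfl
  exact fun i => (mul_eq_zero.mp (hcoef i)).resolve_right (Real.exp_ne_zero _)
end
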